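/- Let I ⊆ A and J ⊆ B be monomial ideals and γ = (α,β) ∈ ℤ^σ × ℤ^τ. Then Δ_γ(I + J) = Δ_α(I) ∗ Δ_β(J); that is, for every subset F of (σ ⊔ τ)∖G_γ, F ∈ Δ_γ(I + J) (computed in S) if and only if F ∩ σ ∈ Δ_α(I) (computed in A) and F ∩ τ ∈ Δ_β(J) (computed in B). -/

import Mathlib

open MvPolynomial

noncomputable section

variable (k : Type*) [Field k]

/-- The multiplicative submonoid of `S = k[x_i : i ∈ σ]` generated by the variables `x_i, i ∈ F`. -/
def varSubmonoid (σ : Type*) (F : Set σ) : Submonoid (MvPolynomial σ k) :=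
  Submonoid.closure ((fun i => (X i : MvPolynomial σ k)) '' F)

/-- The localization `S_F` of `S` at the variables indexed by `F`. -/
abbrev Loc (σ : Type*) (F : Set σ) : Type _ := Localization (varSubmonoid k σ F)

/-- The ideal `I S_F` of `S_F` generated by the image of `I`. -/
def locIdeal {σ : Type*} (I : Ideal (MvPolynomial σ k)) (F : Set σ) : Ideal (Loc k σ F) :=
  Ideal.map (algebraMap (MvPolynomial σ k) (Loc k σ F)) I

/-- `G_γ = {i | γ i < 0}`. -/
def negSupp {σ : Type*} (γ : σ → ℤ) : Set σ := {i | γ i < 0}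

/-- The element `x^γ` of `S_F` (meaningful when `G_γ ⊆ F`):  the image of the monomial with
exponents `max (γ i) 0` multiplied by the inverse of the image of `∏ x_i ^ (-γ i)` over `G_γ`. -/
def xpow {σ : Type*} [Fintype σ] (F : Set σ) (γ : σ → ℤ) : Loc k σ F :=
  algebraMap (MvPolynomial σ k) (Loc k σ F) (∏ i, X i ^ (γ i).toNat) *
    Ring.inverse (algebraMap (MvPolynomial σ k) (Loc k σ F) (∏ i, X i ^ (-γ i).toNat))

/-- The degree complex `Δ_γ(I)`: all `F ⊆ σ \ G_γ` with `x^γ ∉ I S_{F ∪ G_γ}`. -/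
def degCx {σ : Type*} [Fintype σ] (I : Ideal (MvPolynomial σ k)) (γ : σ → ℤ) : Set (Set σ) :=
  {F | F ⊆ (negSupp γ)ᶜ ∧ xpow k (F ∪ negSupp γ) γ ∉ locIdeal k I (F ∪ negSupp γ)}

/-- A monomial ideal is an ideal generated by monomials. -/
def IsMonomialIdeal {σ : Type*} (I : Ideal (MvPolynomial σ k)) : Prop :=
  ∃ G : Set (σ →₀ ℕ),
    I = Ideal.span ((fun d => (monomial d (1 : k) : MvPolynomial σ k)) '' G)

/-- Extension of an ideal of `A = k[x_i : i ∈ σ]` to `S = k[x_i : i ∈ σ ⊕ τ]` along the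
renaming of variables by `Sum.inl`. -/
def extL {σ τ : Type*} (I : Ideal (MvPolynomial σ k)) : Ideal (MvPolynomial (σ ⊕ τ) k) :=
  Ideal.map (rename (Sum.inl : σ → σ ⊕ τ) :
    MvPolynomial σ k →ₐ[k] MvPolynomial (σ ⊕ τ) k).toRingHom I

/-- Extension of an ideal of `B = k[x_i : i ∈ τ]` to `S = k[x_i : i ∈ σ ⊕ τ]` along the
renaming of variables by `Sum.inr`. -/
def extR {σ τ : Type*} (J : Ideal (MvPolynomial τ k)) : Ideal (MvPolynomial (σ ⊕ τ) k) :=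
  Ideal.map (rename (Sum.inr : τ → σ ⊕ τ) :
    MvPolynomial τ k →ₐ[k] MvPolynomial (σ ⊕ τ) k).toRingHom J

/-- The maximal homogeneous ideal, generated by all the variables. -/
def maxIdeal (σ : Type*) : Ideal (MvPolynomial σ k) :=
  Ideal.span (Set.range (X : σ → MvPolynomial σ k))

variable {k}

lemma prod_univ_X_pow_eq_monomial {σ : Type*} [Fintype σ] (c : σ → ℕ) :
    (∏ i, X i ^ c i : MvPolynomial σ k) = monomial (Finsupp.equivFunOnFinite.symm c) 1 := by
  rw [monomial_eq, C_1, one_mul, Finsupp.prod_fintype _ _ (fun i => pow_zero _)]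
  rfl

lemma monomial_mem_varSubmonoid {σ : Type*} {F : Set σ} {e : σ →₀ ℕ}
    (he : ∀ i ∉ F, e i = 0) : (monomial e (1 : k)) ∈ varSubmonoid k σ F := by
  rw [monomial_eq, C_1, one_mul]
  refine prod_mem fun i hi => ?_
  refine pow_mem (Submonoid.subset_closure (Set.mem_image_of_mem _ ?_)) _
  by_contra h
  exact Finsupp.mem_support_iff.1 hi (he i h)

lemma mem_varSubmonoid_iff {σ : Type*} {F : Set σ} {m : MvPolynomial σ k} :
    m ∈ varSubmonoid k σ F ↔ ∃ e : σ →₀ ℕ, (∀ i ∉ F, e i = 0) ∧ m = monomial e 1 := by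
  refine ⟨fun hm => ?_, ?_⟩
  · induction hm using Submonoid.closure_induction with
    | mem x hx =>
      obtain ⟨i, hi, rfl⟩ := hx
      refine ⟨Finsupp.single i 1, fun j hj => Finsupp.single_eq_of_ne ?_, rfl⟩
      rintro rfl
      exact hj hi
    | one => exact ⟨0, fun _ _ => rfl, rfl⟩
    | mul x y _ _ hx hy =>
      obtain ⟨e, he, rfl⟩ := hx
      obtain ⟨e', he', rfl⟩ := hy
      exact ⟨e + e', fun i hi => by simp [he i hi, he' i hi], by simp [monomial_mul]⟩
  · rintro ⟨e, he, rfl⟩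
    exact monomial_mem_varSubmonoid he

/-- Membership of `x^γ` in the localization of a monomial ideal only depends on the exponents of
the generators outside `F`. -/
lemma xpow_mem_locIdeal_span_iff {σ : Type*} [Fintype σ] (G : Set (σ →₀ ℕ)) {F : Set σ}
    {γ : σ → ℤ} (hF : negSupp γ ⊆ F) :
    xpow k F γ ∈ locIdeal k (Ideal.span ((fun d => monomial d (1 : k)) '' G)) F ↔
      ∃ g ∈ G, ∀ i ∉ F, (g i : ℤ) ≤ γ i := by
  have hden : (∏ i, X i ^ (-γ i).toNat : MvPolynomial σ k) ∈ varSubmonoid k σ F := by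
    rw [prod_univ_X_pow_eq_monomial]
    refine monomial_mem_varSubmonoid fun i hi => ?_
    have : ¬ γ i < 0 := fun h => hi (hF h)
    simp only [Finsupp.equivFunOnFinite_symm_apply_apply]
    lia
  have hu : IsUnit (Ring.inverse (algebraMap (MvPolynomial σ k) (Loc k σ F)
      (∏ i, X i ^ (-γ i).toNat))) :=
    (IsLocalization.map_units (Loc k σ F) (⟨_, hden⟩ : varSubmonoid k σ F)).ringInverse
  rw [xpow, locIdeal, Ideal.mul_unit_mem_iff_mem _ hu,
    IsLocalization.algebraMap_mem_map_algebraMap_iff (varSubmonoid k σ F), prod_univ_X_pow_eq_monomial]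
  classical
  constructor
  · rintro ⟨m, hm, h⟩
    obtain ⟨e, he, rfl⟩ := mem_varSubmonoid_iff.1 hm
    rw [monomial_mul, one_mul, mem_ideal_span_monomial_image] at h
    obtain ⟨g, hg, hle⟩ := h (e + Finsupp.equivFunOnFinite.symm _)
      (by rw [mem_support_iff, coeff_monomial, if_pos rfl]; exact one_ne_zero)
    refine ⟨g, hg, fun i hi => ?_⟩
    have h1 := hle i
    have : ¬ γ i < 0 := fun h => hi (hF h)
    simp only [Finsupp.add_apply, he i hi, Finsupp.equivFunOnFinite_symm_apply_apply] at h1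
    lia
  · rintro ⟨g, hg, h⟩
    refine ⟨monomial (g.filter (· ∈ F)) 1,
      monomial_mem_varSubmonoid fun i hi => Finsupp.filter_apply_neg _ _ hi, ?_⟩
    rw [monomial_mul, one_mul, mem_ideal_span_monomial_image]
    intro x hx
    rw [Finset.mem_singleton.1 (support_monomial_subset hx)]
    refine ⟨g, hg, fun i => ?_⟩
    by_cases hi : i ∈ F
    · simp [hi]
    · have := h i hi
      simp only [Finsupp.add_apply, Finsupp.equivFunOnFinite_symm_apply_apply]
      lia

lemma mem_degCx_span_iff {σ : Type*} [Fintype σ] (G : Set (σ →₀ ℕ)) {F : Set σ} {γ : σ → ℤ} :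
    F ∈ degCx k (Ideal.span ((fun d => monomial d (1 : k)) '' G)) γ ↔
      F ⊆ (negSupp γ)ᶜ ∧ ¬ ∃ g ∈ G, ∀ i ∉ F ∪ negSupp γ, (g i : ℤ) ≤ γ i := by
  rw [← xpow_mem_locIdeal_span_iff (k := k) G Set.subset_union_right]
  rfl

lemma extL_span_monomial {σ τ : Type*} (G : Set (σ →₀ ℕ)) :
    extL (τ := τ) k (Ideal.span ((fun d => monomial d (1 : k)) '' G)) =
      Ideal.span ((fun d => monomial d (1 : k)) '' (Finsupp.mapDomain Sum.inl '' G)) := by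
  rw [extL, Ideal.map_span, Set.image_image, Set.image_image]
  simp [rename_monomial]

lemma extR_span_monomial {σ τ : Type*} (H : Set (τ →₀ ℕ)) :
    extR (σ := σ) k (Ideal.span ((fun d => monomial d (1 : k)) '' H)) =
      Ideal.span ((fun d => monomial d (1 : k)) '' (Finsupp.mapDomain Sum.inr '' H)) := by
  rw [extR, Ideal.map_span, Set.image_image, Set.image_image]
  simp [rename_monomial]

variable (k)

/-- for monomial ideals `I ⊆ A`, `J ⊆ B` and `γ = (α, β)`,
`Δ_γ(I + J) = Δ_α(I) ∗ Δ_β(J)`: for every `F ⊆ (σ ⊔ τ) \ G_γ`, `F ∈ Δ_γ(I + J)` iff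
`F ∩ σ ∈ Δ_α(I)` and `F ∩ τ ∈ Δ_β(J)`. -/
theorem statement7 {σ τ : Type*} [Fintype σ] [Fintype τ]
    (I : Ideal (MvPolynomial σ k)) (J : Ideal (MvPolynomial τ k))
    (hI : IsMonomialIdeal k I) (hJ : IsMonomialIdeal k J) (α : σ → ℤ) (β : τ → ℤ) :
    ∀ F : Set (σ ⊕ τ), F ⊆ (negSupp (Sum.elim α β))ᶜ →
      (F ∈ degCx k (extL k I + extR k J) (Sum.elim α β) ↔
        Sum.inl ⁻¹' F ∈ degCx k I α ∧ Sum.inr ⁻¹' F ∈ degCx k J β) := by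
  intro F hF
  obtain ⟨G, rfl⟩ := hI
  obtain ⟨H, rfl⟩ := hJ
  have hα : Sum.inl ⁻¹' F ⊆ (negSupp α)ᶜ := fun i hi => hF hi
  have hβ : Sum.inr ⁻¹' F ⊆ (negSupp β)ᶜ := fun i hi => hF hi
  rw [extL_span_monomial, extR_span_monomial, Submodule.add_eq_sup, ← Ideal.span_union,
    ← Set.image_union, mem_degCx_span_iff, mem_degCx_span_iff, mem_degCx_span_iff]
  simp only [hF, hα, hβ, true_and, ← not_or]
  have hl (g : σ →₀ ℕ) (j : τ) : Finsupp.mapDomain (Sum.inl : σ → σ ⊕ τ) g (Sum.inr j) = 0 :=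
    Finsupp.mapDomain_of_notMem_range _ _ (by simp)
  have hr (g : τ →₀ ℕ) (i : σ) : Finsupp.mapDomain (Sum.inr : τ → σ ⊕ τ) g (Sum.inl i) = 0 :=
    Finsupp.mapDomain_of_notMem_range _ _ (by simp)
  refine not_congr ?_
  simp only [Set.mem_union, or_and_right, exists_or, Set.exists_mem_image, Sum.forall, hl, hr,
    Finsupp.mapDomain_apply Sum.inl_injective, Finsupp.mapDomain_apply Sum.inr_injective]
  simp +contextual [negSupp, not_or]
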